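/- Let Σ be a real symmetric positive semidefinite d×d matrix, γ > 0, and λ > 0. Then there exists a unique κ > 0 satisfying the self-consistent (Silverstein) equation κ − λ = γ·κ·tr[Σ(Σ + κI)^{-1}], where tr denotes the normalized trace (tr[I] = 1). Moreover this solution satisfies κ ≥ λ, with strict inequality κ > λ whenever Σ ≠ 0. -/

import Mathlib

open Matrix

/-- The trace of `A (A + κI)⁻¹` as a sum over the eigenvalues of `A`. -/
theorem Matrix.PosSemidef.trace_mul_inv_add_smul_one {n : Type*} [Fintype n] [DecidableEq n]
    {A : Matrix n n ℝ} (hA : A.PosSemidef) {κ : ℝ} (hκ : 0 < κ) :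
    (A * (A + κ • (1 : Matrix n n ℝ))⁻¹).trace =
      ∑ i, hA.isHermitian.eigenvalues i / (hA.isHermitian.eigenvalues i + κ) := by
  set e := hA.isHermitian.eigenvalues
  set U : Matrix n n ℝ := (hA.isHermitian.eigenvectorUnitary).1
  have hU : star U * U = 1 := Unitary.coe_star_mul_self hA.isHermitian.eigenvectorUnitary
  have hU' : U * star U = 1 := Unitary.coe_mul_star_self hA.isHermitian.eigenvectorUnitary
  have hS : A = U * diagonal e * star U := by
    simpa [Unitary.conjStarAlgAut_apply] using hA.isHermitian.spectral_theorem
  have hpos : ∀ i, e i + κ ≠ 0 := fun i =>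
    (add_pos_of_nonneg_of_pos (hA.eigenvalues_nonneg i) hκ).ne'
  have hadd : A + κ • (1 : Matrix n n ℝ) = U * diagonal (fun i => e i + κ) * star U := by
    have h : diagonal (fun i => e i + κ) = diagonal e + κ • (1 : Matrix n n ℝ) := by
      rw [smul_one_eq_diagonal, diagonal_add]
    rw [h, mul_add, add_mul, ← hS, mul_smul_comm, mul_one, smul_mul_assoc, hU']
  have hinv : (A + κ • (1 : Matrix n n ℝ))⁻¹
      = U * diagonal (fun i => (e i + κ)⁻¹) * star U := by
    refine inv_eq_right_inv ?_
    calc _ = U * (diagonal (fun i => e i + κ) * (star U * U) *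
              diagonal (fun i => (e i + κ)⁻¹)) * star U := by
            rw [hadd]; simp only [mul_assoc]
      _ = 1 := by simp [hU, hU', hpos, diagonal_mul_diagonal]
  calc _ = (U * (diagonal e * (star U * U) * diagonal (fun i => (e i + κ)⁻¹)) * star U).trace := by
          rw [hinv]; nth_rewrite 1 [hS]; simp only [mul_assoc]
    _ = _ := by
      rw [trace_mul_comm, ← mul_assoc, hU, one_mul, mul_one, diagonal_mul_diagonal, trace_diagonal]
      simp only [div_eq_mul_inv]

/-- The scalar form `κ - l = c κ ∑ i, e i / (e i + κ)` of the self-consistent equation has a unique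
positive solution. -/
theorem existsUnique_sub_eq_mul_sum_div_add {ι : Type*} [Fintype ι] {e : ι → ℝ}
    (he : ∀ i, 0 ≤ e i) {c l : ℝ} (hc : 0 ≤ c) (hl : 0 < l) :
    ∃! κ : ℝ, 0 < κ ∧ κ - l = c * κ * ∑ i, e i / (e i + κ) := by
  have hsum : ∀ κ, 0 < κ → 0 ≤ ∑ i, e i / (e i + κ) := fun κ hκ =>
    Finset.sum_nonneg fun i _ => div_nonneg (he i) (add_nonneg (he i) hκ.le)
  refine existsUnique_of_exists_of_unique ?_ ?_
  · have hcont : ContinuousOn (fun κ => κ - l - c * κ * ∑ i, e i / (e i + κ))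
        (Set.Icc l (l + c * ∑ i, e i)) := by
      refine (by fun_prop : ContinuousOn (fun κ : ℝ => κ - l) _).sub
        ((by fun_prop : ContinuousOn (fun κ : ℝ => c * κ) _).mul
          (continuousOn_finsetSum _ fun i _ => ?_))
      refine continuousOn_const.div (by fun_prop) fun κ hκ => ?_
      linarith [he i, hκ.1]
    have hK : l ≤ l + c * ∑ i, e i :=
      le_add_of_nonneg_right (mul_nonneg hc (Finset.sum_nonneg fun i _ => he i))
    obtain ⟨κ, hκ, h0⟩ := intermediate_value_Icc hK hcont (show (0 : ℝ) ∈ Set.Icc _ _ from by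
      constructor
      · have := mul_nonneg (mul_nonneg hc hl.le) (hsum l hl)
        simpa using this
      · set K := l + c * ∑ i, e i
        have hKpos : 0 < K := hl.trans_le hK
        have : K * ∑ i, e i / (e i + K) ≤ ∑ i, e i := by
          rw [Finset.mul_sum]
          refine Finset.sum_le_sum fun i _ => ?_
          rw [mul_div_assoc', div_le_iff₀ (add_pos_of_nonneg_of_pos (he i) hKpos)]
          nlinarith [sq_nonneg (e i)]
        have := mul_le_mul_of_nonneg_left this hc
        simp only [K] at *
        linarith)
    exact ⟨κ, hl.trans_le hκ.1, sub_eq_zero.mp h0⟩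
  · have key : ∀ x y : ℝ, 0 < x → x < y → x - l = c * x * ∑ i, e i / (e i + x) →
        y - l = c * y * ∑ i, e i / (e i + y) → False := by
      intro x y hx hxy h1 h2
      have hle : ∑ i, e i / (e i + y) ≤ ∑ i, e i / (e i + x) :=
        Finset.sum_le_sum fun i _ => div_le_div_of_nonneg_left (he i)
          (add_pos_of_nonneg_of_pos (he i) hx) (by linarith)
      have h3 := mul_le_mul_of_nonneg_left hle (mul_nonneg (mul_nonneg hc hx.le) (hx.trans hxy).le)
      have h4 : x * (y - l) ≤ y * (x - l) := by rw [h1, h2]; linarith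
      nlinarith [mul_pos hl (sub_pos.mpr hxy)]
    rintro x y ⟨hx, h1⟩ ⟨hy, h2⟩
    rcases lt_trichotomy x y with h | h | h
    · exact (key x y hx h h1 h2).elim
    · exact h
    · exact (key y x hy h h2 h1).elim



/-- **Silverstein self-consistent equation.** Let `Σ` be a real symmetric
positive semidefinite `d×d` matrix, `γ > 0`, and `λ > 0`. Then there exists a unique
`κ > 0` satisfying `κ − λ = γ·κ·tr[Σ(Σ + κI)⁻¹]`, where `tr` is the normalized trace
(`tr[I] = 1`, i.e. `tr[M] = Tr[M]/d`). Moreover every such solution satisfies `κ ≥ λ`,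
with strict inequality `κ > λ` whenever `Σ ≠ 0`. -/
theorem silverstein_unique_solution {d : ℕ} (hd : 0 < d)
    (S : Matrix (Fin d) (Fin d) ℝ) (hS : S.PosSemidef) (γ lam : ℝ)
    (hγ : 0 < γ) (hlam : 0 < lam) :
    (∃! κ : ℝ, 0 < κ ∧
        κ - lam = γ * κ * ((S * (S + κ • (1 : Matrix (Fin d) (Fin d) ℝ))⁻¹).trace / d)) ∧
      ∀ κ : ℝ, 0 < κ →
        κ - lam = γ * κ * ((S * (S + κ • (1 : Matrix (Fin d) (Fin d) ℝ))⁻¹).trace / d) →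
        lam ≤ κ ∧ (S ≠ 0 → lam < κ) := by
  have he := hS.eigenvalues_nonneg
  have hcd : 0 < γ / d := div_pos hγ (Nat.cast_pos.mpr hd)
  have hiff : ∀ κ : ℝ, 0 < κ →
      γ * κ * ((S * (S + κ • (1 : Matrix (Fin d) (Fin d) ℝ))⁻¹).trace / d) =
        γ / d * κ * ∑ i, hS.isHermitian.eigenvalues i / (hS.isHermitian.eigenvalues i + κ) := by
    intro κ hκ
    rw [hS.trace_mul_inv_add_smul_one hκ]
    ring
  have hnonneg : ∀ κ : ℝ, 0 < κ → ∀ i,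
      0 ≤ hS.isHermitian.eigenvalues i / (hS.isHermitian.eigenvalues i + κ) :=
    fun κ hκ i => div_nonneg (he i) (add_nonneg (he i) hκ.le)
  refine ⟨?_, fun κ hκ h => ⟨?_, fun hne => ?_⟩⟩
  · refine (existsUnique_congr fun κ => and_congr_right fun hκ => ?_).mpr
      (existsUnique_sub_eq_mul_sum_div_add he hcd.le hlam)
    rw [hiff κ hκ]
  · rw [hiff κ hκ] at h
    have := mul_nonneg (mul_pos hcd hκ).le (Finset.sum_nonneg (s := Finset.univ) fun i _ => hnonneg κ hκ i)
    linarith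
  · rw [hiff κ hκ] at h
    obtain ⟨i, hi⟩ := Function.ne_iff.mp (mt hS.isHermitian.eigenvalues_eq_zero_iff.mp hne)
    have hi' := (he i).lt_of_ne' hi
    have := mul_pos (mul_pos hcd hκ) (Finset.sum_pos' (fun i _ => hnonneg κ hκ i)
      ⟨i, Finset.mem_univ i, div_pos hi' (add_pos hi' hκ)⟩)
    linarith
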